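/- arXiv:2107.01488 — 2 statements merged into one kernel-verified Lean document; each statement's English description precedes it below -/
import Mathlib

section
/- For every real a > 0 and every complex number z not lying in the closed negative real axis (-∞, 0], ∫_a^∞ 1/(t² + z) dt = (1/√z) · Arctan(√z / a), where √z is the principal branch of the complex square root and Arctan(w) = (i/2) · log((1 - i w)/(1 + i w)) with the principal branch of the complex logarithm. -/
open MeasureTheory

/-- The principal branch of the complex arctangent,
`Arctan(w) = (i/2) log((1 - i w)/(1 + i w))`. -/
noncomputable def carctan (w : ℂ) : ℂ :=
  (Complex.I / 2) * Complex.log ((1 - Complex.I * w) / (1 + Complex.I * w))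

open Filter Topology

theorem one_add_I_mul_ne_zero_of_re_ne_zero {w : ℂ} (hw : w.re ≠ 0) :
    1 + Complex.I * w ≠ 0 := fun h => hw <| by
  simpa using congrArg Complex.im h

theorem one_sub_I_mul_div_mem_slitPlane_of_re_ne_zero {w : ℂ} (hw : w.re ≠ 0) :
    (1 - Complex.I * w) / (1 + Complex.I * w) ∈ Complex.slitPlane := by
  refine Or.inr ?_
  have hN : Complex.normSq (1 + Complex.I * w) ≠ 0 :=
    (Complex.normSq_pos.mpr (one_add_I_mul_ne_zero_of_re_ne_zero hw)).ne'
  have him : ((1 - Complex.I * w) / (1 + Complex.I * w)).im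
      = -2 * w.re / Complex.normSq (1 + Complex.I * w) := by
    rw [Complex.div_im]
    simp only [Complex.add_im, Complex.add_re, Complex.sub_im, Complex.sub_re, Complex.mul_im,
      Complex.mul_re, Complex.I_re, Complex.I_im, Complex.one_re, Complex.one_im]
    ring
  rw [him]
  exact div_ne_zero (by simpa using hw) hN

theorem hasDerivAt_carctan {w : ℂ} (hw : w.re ≠ 0) :
    HasDerivAt carctan (1 + w ^ 2)⁻¹ w := by
  have h1 : 1 + Complex.I * w ≠ 0 := one_add_I_mul_ne_zero_of_re_ne_zero hw
  have h2 : 1 - Complex.I * w ≠ 0 := by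
    simpa [sub_eq_add_neg] using
      one_add_I_mul_ne_zero_of_re_ne_zero (w := -w) (by simpa using hw)
  have hmul : HasDerivAt (fun v : ℂ => Complex.I * v) Complex.I w := by
    simpa using (hasDerivAt_id w).const_mul Complex.I
  have h := (((hmul.const_sub 1).div (hmul.const_add 1) h1).clog
    (one_sub_I_mul_div_mem_slitPlane_of_re_ne_zero hw)).const_mul (Complex.I / 2)
  refine h.congr_deriv ?_
  have hfac : 1 + w ^ 2 = (1 + Complex.I * w) * (1 - Complex.I * w) := by
    linear_combination w ^ 2 * Complex.I_sq
  simp only [Pi.div_apply]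
  rw [hfac]
  field_simp
  linear_combination -2 * Complex.I_sq

theorem tendsto_carctan_zero : Tendsto carctan (𝓝 0) (𝓝 0) := by
  have h : ContinuousAt carctan 0 := by
    unfold carctan
    refine continuousAt_const.mul (ContinuousAt.clog ?_ (by simp))
    exact ContinuousAt.div (by fun_prop) (by fun_prop) (by simp)
  simpa [ContinuousAt, carctan] using h

theorem integrableOn_Ioi_inv_sq_add {a : ℝ} {z : ℂ}
    (h : ∀ t ∈ Set.Ici a, (t : ℂ) ^ 2 + z ≠ 0) :
    IntegrableOn (fun t : ℝ => ((t : ℂ) ^ 2 + z)⁻¹) (Set.Ioi a) := by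
  have hcont : ContinuousOn (fun t : ℝ => ((t : ℂ) ^ 2 + z)⁻¹) (Set.Ici a) :=
    ContinuousOn.inv₀ (by fun_prop) h
  have hO : (fun t : ℝ => ((t : ℂ) ^ 2 + z)⁻¹) =O[atTop] fun t : ℝ => t ^ (-2 : ℝ) := by
    refine Asymptotics.IsBigO.of_bound 2 ?_
    filter_upwards [eventually_gt_atTop 0,
      (tendsto_pow_atTop two_ne_zero).eventually_ge_atTop (2 * ‖z‖)] with t ht hzt
    have hlow : t ^ 2 / 2 ≤ ‖(t : ℂ) ^ 2 + z‖ := by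
      have := norm_sub_le_norm_add ((t : ℂ) ^ 2) z
      rw [norm_pow, Complex.norm_real, Real.norm_eq_abs, sq_abs] at this
      linarith
    rw [norm_inv, Real.rpow_neg ht.le, Real.rpow_two, Real.norm_of_nonneg (by positivity)]
    calc ‖(t : ℂ) ^ 2 + z‖⁻¹ ≤ (t ^ 2 / 2)⁻¹ := inv_anti₀ (by positivity) hlow
      _ = 2 * (t ^ 2)⁻¹ := by rw [inv_div, div_eq_mul_inv]
  refine ((hcont.locallyIntegrableOn measurableSet_Ici).integrableOn_of_isBigO_atTop hO
    ⟨Set.Ioi 1, Ioi_mem_atTop 1, ?_⟩).mono_set Set.Ioi_subset_Ici_self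
  exact integrableOn_Ioi_rpow_of_lt (by norm_num) one_pos

theorem re_cpow_half_pos {z : ℂ} (hz : z ∈ Complex.slitPlane) : 0 < (z ^ (1 / 2 : ℂ)).re := by
  have harg := Complex.mem_slitPlane_iff_arg.mp hz
  have him : (Complex.log z * (1 / 2)).im = z.arg / 2 := by
    simp [div_eq_mul_inv, Complex.log_im]
  rw [Complex.cpow_def_of_ne_zero harg.2, Complex.exp_re, him]
  refine mul_pos (Real.exp_pos _) (Real.cos_pos_of_mem_Ioo ⟨?_, ?_⟩)
  · linarith [Complex.neg_pi_lt_arg z]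
  · linarith [lt_of_le_of_ne (Complex.arg_le_pi z) harg.1]

theorem integral_Ioi_inv_sq_add_sq {a : ℝ} (ha : 0 < a) {s : ℂ} (hs : 0 < s.re) :
    (∫ t in Set.Ioi a, ((t : ℂ) ^ 2 + s ^ 2)⁻¹) = s⁻¹ * carctan (s / a) := by
  have hs0 : s ≠ 0 := by rintro rfl; simp at hs
  have hre (t : ℝ) (ht : t ∈ Set.Ici a) : (s / t).re ≠ 0 := by
    rw [Complex.div_ofReal_re]
    exact (div_pos hs (ha.trans_le ht)).ne'
  have ht0 (t : ℝ) (ht : t ∈ Set.Ici a) : (t : ℂ) ≠ 0 :=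
    Complex.ofReal_ne_zero.mpr (ha.trans_le ht).ne'
  have hne (t : ℝ) (ht : t ∈ Set.Ici a) : (t : ℂ) ^ 2 + s ^ 2 ≠ 0 := by
    have h1 := one_add_I_mul_ne_zero_of_re_ne_zero (hre t ht)
    have h2 := one_add_I_mul_ne_zero_of_re_ne_zero (w := -(s / t)) (by simpa using hre t ht)
    have := mul_ne_zero (mul_ne_zero h1 h2) (pow_ne_zero 2 (ht0 t ht))
    convert this using 1
    have h0 := ht0 t ht
    field_simp
    linear_combination s ^ 2 * Complex.I_sq
  have hderiv (t : ℝ) (ht : t ∈ Set.Ici a) :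
      HasDerivAt (fun t : ℝ => -s⁻¹ * carctan (s / t)) ((t : ℂ) ^ 2 + s ^ 2)⁻¹ t := by
    have h0 := ht0 t ht
    have hdiv : HasDerivAt (fun v : ℂ => s / v) (-s / (t : ℂ) ^ 2) (t : ℂ) := by
      simpa [div_eq_mul_inv] using (hasDerivAt_inv h0).const_mul s
    have h := (((hasDerivAt_carctan (hre t ht)).comp (t : ℂ) hdiv).const_mul
      (-s⁻¹)).comp_ofReal
    refine h.congr_deriv ?_
    have h1 : 1 + (s / t) ^ 2 = ((t : ℂ) ^ 2 + s ^ 2) / (t : ℂ) ^ 2 := by field_simp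
    have h2 := hne t ht
    rw [h1]
    field_simp
  have hlim : Tendsto (fun t : ℝ => -s⁻¹ * carctan (s / t)) atTop (𝓝 0) := by
    have hdiv : Tendsto (fun t : ℝ => s / (t : ℂ)) atTop (𝓝 0) := by
      have h := (Complex.continuous_ofReal.tendsto 0).comp tendsto_inv_atTop_zero
      simpa [Function.comp_def, div_eq_mul_inv] using h.const_mul s
    simpa using (tendsto_carctan_zero.comp hdiv).const_mul (-s⁻¹)
  rw [integral_Ioi_of_hasDerivAt_of_tendsto' hderiv (integrableOn_Ioi_inv_sq_add hne) hlim]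
  ring

/-- For `a > 0` and `z ∈ ℂ \ (-∞,0]`,
`∫_a^∞ dt/(t² + z) = (1/√z) Arctan(√z/a)` with the principal branch of the square root. -/
theorem integral_tail_inv_sq_add (a : ℝ) (ha : 0 < a) (z : ℂ)
    (hz : ∀ x : ℝ, x ≤ 0 → z ≠ (x : ℂ)) :
    (∫ t in Set.Ioi a, ((t:ℂ)^2 + z)⁻¹)
      = (z ^ (1/2 : ℂ))⁻¹ * carctan (z ^ (1/2 : ℂ) / (a:ℂ)) := by
  have hslit : z ∈ Complex.slitPlane := by
    by_contra h
    rw [Complex.mem_slitPlane_iff, not_or, not_lt, not_not] at h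
    exact hz z.re h.1 (Complex.ext rfl (by simpa using h.2))
  have hsq : (z ^ (1 / 2 : ℂ)) ^ 2 = z := by
    rw [one_div]
    exact_mod_cast Complex.cpow_nat_inv_pow z two_ne_zero
  rw [← integral_Ioi_inv_sq_add_sq ha (re_cpow_half_pos hslit), hsq]
end

section
/- Let n ≥ 1 be a natural number, M a positive integer, ε ≥ 0, and let w₁,…,w_M and η₁,…,η_M be complex numbers such that |(1-s)^{n-1/2} - ∑_{m=1}^M w_m e^{η_m s}| ≤ ε for all s ∈ [0,1]. Then for every complex number z with Re(z) ≥ 0, |F(n,z) - (1/2) ∑_{m=1}^M w_m e^{η_m} q(z + η_m)| ≤ (ε/2)·r(Re z) ≤ ε/2, where q : ℂ → ℂ is defined by q(ξ) = (1 - e^{-ξ})/ξ for ξ ≠ 0 and q(0) = 1, and r : ℝ → ℝ is defined by r(x) = (1 - e^{-x})/x for x ≠ 0 and r(0) = 1. -/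
open MeasureTheory

/-- The Boys function `F(n,z) = ∫₀¹ e^{-z t²} t^{2n} dt`. -/
noncomputable def boys (n : ℕ) (z : ℂ) : ℂ :=
  ∫ t in (0:ℝ)..1, Complex.exp (-z * (t:ℂ)^2) * (t:ℂ)^(2*n)

/-- The analytic function `q(ξ) = (1 - e^{-ξ})/ξ`, with `q(0) = 1`. -/
noncomputable def qfun (ξ : ℂ) : ℂ :=
  if ξ = 0 then 1 else (1 - Complex.exp (-ξ)) / ξ

/-- The real analogue `r(x) = (1 - e^{-x})/x`, with `r(0) = 1`. -/
noncomputable def rfun (x : ℝ) : ℝ :=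
  if x = 0 then 1 else (1 - Real.exp (-x)) / x

theorem qfun_eq_integral (ξ : ℂ) :
    qfun ξ = ∫ u in (0:ℝ)..1, Complex.exp (-ξ * u) := by
  unfold qfun
  split_ifs with h
  · simp [h]
  · rw [integral_exp_mul_complex (neg_ne_zero.mpr h)]
    simp only [Complex.ofReal_one, Complex.ofReal_zero, mul_one, mul_zero, Complex.exp_zero]
    rw [div_neg, ← neg_div, neg_sub]

theorem rfun_eq_integral (x : ℝ) :
    rfun x = ∫ u in (0:ℝ)..1, Real.exp (-x * u) := by
  have hq : qfun x = rfun x := by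
    unfold qfun rfun
    split_ifs with h h' h' <;> simp_all
  apply Complex.ofReal_injective
  rw [← hq, qfun_eq_integral, ← intervalIntegral.integral_ofReal]
  push_cast
  rfl

theorem rfun_le_one {x : ℝ} (hx : 0 ≤ x) : rfun x ≤ 1 := by
  unfold rfun
  split_ifs with h
  · rfl
  · rw [div_le_one (lt_of_le_of_ne hx (Ne.symm h))]
    linarith [Real.add_one_le_exp (-x)]

theorem continuous_exp_mul_rpow_sub_half {n : ℕ} (hn : 1 ≤ n) (z : ℂ) :
    Continuous fun u : ℝ => Complex.exp (-z * u) * ((u ^ ((n:ℝ) - 1/2) : ℝ) : ℂ) := by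
  have hn' : (1:ℝ) ≤ n := by exact_mod_cast hn
  exact (by fun_prop : Continuous fun u : ℝ => Complex.exp (-z * u)).mul
    (Complex.continuous_ofReal.comp (Real.continuous_rpow_const (by linarith)))

/-- The substitution `u = t²` in the Boys function. -/
theorem boys_eq_integral_rpow {n : ℕ} (hn : 1 ≤ n) (z : ℂ) :
    boys n z = (1/2) * ∫ u in (0:ℝ)..1,
      Complex.exp (-z * u) * ((u ^ ((n:ℝ) - 1/2) : ℝ) : ℂ) := by
  have hsub := intervalIntegral.integral_deriv_smul_comp (a := 0) (b := 1)
    (f := fun t : ℝ => t ^ 2) (f' := fun t => 2 * t)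
    (fun t _ => by simpa using hasDerivAt_pow 2 t) (by fun_prop)
    (continuous_exp_mul_rpow_sub_half hn z)
  simp only [ne_eq, OfNat.ofNat_ne_zero, not_false_eq_true, zero_pow, one_pow] at hsub
  rw [← hsub, boys, ← intervalIntegral.integral_const_mul]
  refine intervalIntegral.integral_congr fun t ht => ?_
  rw [Set.uIcc_of_le zero_le_one] at ht
  have hpow : t * (t ^ 2) ^ ((n:ℝ) - 1/2) = t ^ (2 * n) := by
    rcases ht.1.eq_or_lt with rfl | h
    · simp [show n ≠ 0 by omega]
    · rw [← Real.rpow_natCast t 2, ← Real.rpow_mul h.le]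
      conv_lhs => rw [← Real.rpow_one t, ← Real.rpow_mul h.le, ← Real.rpow_add h]
      rw [← Real.rpow_natCast]
      congr 1
      push_cast
      ring
  have hpow' : (t:ℂ) * (((t ^ 2) ^ ((n:ℝ) - 1/2) : ℝ) : ℂ) = (t:ℂ) ^ (2 * n) := by
    exact_mod_cast congrArg Complex.ofReal hpow
  simp only [Function.comp, Complex.real_smul]
  rw [← hpow']
  push_cast
  ring

theorem sum_exp_mul_qfun_eq_integral {ι : Type*} [Fintype ι] (w η : ι → ℂ) (z : ℂ) :
    ∑ m, w m * Complex.exp (η m) * qfun (z + η m) =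
      ∫ u in (0:ℝ)..1, Complex.exp (-z * u) *
        ∑ m, w m * Complex.exp (η m * ((1 - u : ℝ) : ℂ)) := by
  simp only [Finset.mul_sum]
  rw [intervalIntegral.integral_finsetSum fun m _ =>
    Continuous.intervalIntegrable (by fun_prop) _ _]
  refine Finset.sum_congr rfl fun m _ => ?_
  rw [qfun_eq_integral, ← intervalIntegral.integral_const_mul]
  refine intervalIntegral.integral_congr fun u _ => ?_
  rw [mul_assoc, mul_left_comm (Complex.exp (-z * u)), ← Complex.exp_add, ← Complex.exp_add]
  push_cast
  ring_nf

/-- If `(1-s)^{n-1/2}` is approximated by `∑ w_m e^{η_m s}` uniformly on `[0,1]` with error `ε`,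
then for `Re z ≥ 0`, `|F(n,z) - (1/2) ∑ w_m e^{η_m} q(z + η_m)| ≤ (ε/2) r(Re z) ≤ ε/2`. -/
theorem boys_exponential_approximation (n : ℕ) (hn : 1 ≤ n) (M : ℕ) (hM : 0 < M)
    (ε : ℝ) (hε : 0 ≤ ε) (w η : Fin M → ℂ)
    (happrox : ∀ s ∈ Set.Icc (0:ℝ) 1,
      ‖((((1 - s) ^ ((n:ℝ) - 1/2) : ℝ)) : ℂ) - ∑ m, w m * Complex.exp (η m * s)‖ ≤ ε)
    (z : ℂ) (hz : 0 ≤ z.re) :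
    ‖boys n z - (1/2) * ∑ m, w m * Complex.exp (η m) * qfun (z + η m)‖
        ≤ (ε/2) * rfun z.re
    ∧ (ε/2) * rfun z.re ≤ ε/2 := by
  refine ⟨?_, mul_le_of_le_one_right (by positivity) (rfun_le_one hz)⟩
  rw [boys_eq_integral_rpow hn, sum_exp_mul_qfun_eq_integral, ← mul_sub,
    ← intervalIntegral.integral_sub
      ((continuous_exp_mul_rpow_sub_half hn z).intervalIntegrable _ _)
      (Continuous.intervalIntegrable (by fun_prop) _ _), norm_mul]
  have hbound : ‖∫ u in (0:ℝ)..1,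
      (Complex.exp (-z * u) * ((u ^ ((n:ℝ) - 1/2) : ℝ) : ℂ) - Complex.exp (-z * u) *
        ∑ m, w m * Complex.exp (η m * ((1 - u : ℝ) : ℂ)))‖ ≤
      ∫ u in (0:ℝ)..1, ε * Real.exp (-z.re * u) := by
    refine intervalIntegral.norm_integral_le_of_norm_le zero_le_one
      (Filter.Eventually.of_forall fun u hu => ?_)
      (Continuous.intervalIntegrable (by fun_prop) _ _)
    have happ := happrox (1 - u) ⟨by linarith [hu.2], by linarith [hu.1]⟩
    rw [sub_sub_cancel] at happ
    rw [← mul_sub, norm_mul, Complex.norm_exp, mul_comm ε]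
    have hre : (-z * (u:ℂ)).re = -z.re * u := by simp
    rw [hre]
    gcongr
  rw [intervalIntegral.integral_const_mul, ← rfun_eq_integral] at hbound
  have hhalf : ‖(1/2 : ℂ)‖ = 1/2 := by norm_num
  rw [hhalf]
  linarith
end
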